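/- arXiv:2412.02392 — 3 statements merged into one kernel-verified Lean document; each statement's English description precedes it below -/
import Mathlib

section
/- For all nonzero integers a and b, there do not exist nonnegative real numbers d₁, …, d₈ satisfying simultaneously the following four strict inequalities: (i) if a > 0 then d₂ + d₈ > d₃ + a·d₇, and if a < 0 then d₂ + d₈ > d₃ + (−a)·d₅; (ii) if a > 0 then d₃ + d₆ > a·d₅ + d₈, and if a < 0 then d₃ + d₆ > (−a)·d₇ + d₈; (iii) if b > 0 then d₁ + d₅ > d₄ + b·d₆, and if b < 0 then d₁ + d₅ > (−b)·d₂ + d₄; (iv) if b > 0 then d₄ + d₇ > d₁ + b·d₂, and if b < 0 then d₄ + d₇ > d₁ + (−b)·d₆. (This is the infeasibility of the ample-divisor inequality system attached to the primitive relations of the toric threefold Z′₁₃(a,b) of type [8-13′]; it proves Z′₁₃(a,b) is not projective whenever ab ≠ 0.) -/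
/-- Infeasibility of the ample-divisor inequality system attached to the
primitive relations of the toric threefold `Z′₁₃(a,b)` of type [8-13′]; it
proves that `Z′₁₃(a,b)` is not projective whenever `a ≠ 0` and `b ≠ 0`. -/
theorem oda_8_13'_nonprojective (a b : ℤ) (ha : a ≠ 0) (hb : b ≠ 0) :
    ¬ ∃ d₁ d₂ d₃ d₄ d₅ d₆ d₇ d₈ : ℝ,
      0 ≤ d₁ ∧ 0 ≤ d₂ ∧ 0 ≤ d₃ ∧ 0 ≤ d₄ ∧ 0 ≤ d₅ ∧ 0 ≤ d₆ ∧ 0 ≤ d₇ ∧ 0 ≤ d₈ ∧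
      (a > 0 → d₂ + d₈ > d₃ + (a : ℝ) * d₇) ∧
      (a < 0 → d₂ + d₈ > d₃ + ((-a : ℤ) : ℝ) * d₅) ∧
      (a > 0 → d₃ + d₆ > (a : ℝ) * d₅ + d₈) ∧
      (a < 0 → d₃ + d₆ > ((-a : ℤ) : ℝ) * d₇ + d₈) ∧
      (b > 0 → d₁ + d₅ > d₄ + (b : ℝ) * d₆) ∧
      (b < 0 → d₁ + d₅ > ((-b : ℤ) : ℝ) * d₂ + d₄) ∧
      (b > 0 → d₄ + d₇ > d₁ + (b : ℝ) * d₂) ∧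
      (b < 0 → d₄ + d₇ > d₁ + ((-b : ℤ) : ℝ) * d₆) := by
  rintro ⟨d₁, d₂, d₃, d₄, d₅, d₆, d₇, d₈, -, h₂, -, -, h₅, h₆, h₇, -,
    pa₁, na₁, pa₂, na₂, pb₁, nb₁, pb₂, nb₂⟩
  have le_int_mul {n : ℤ} (hn : 0 < n) {x : ℝ} (hx : 0 ≤ x) : x ≤ (n : ℝ) * x :=
    le_mul_of_one_le_left hx (by exact_mod_cast hn)
  have lower : d₅ + d₇ < d₂ + d₆ := by
    rcases ha.lt_or_gt with h | h
    · linarith [na₁ h, na₂ h, le_int_mul (neg_pos.2 h) h₅, le_int_mul (neg_pos.2 h) h₇]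
    · linarith [pa₁ h, pa₂ h, le_int_mul h h₅, le_int_mul h h₇]
  have upper : d₂ + d₆ < d₅ + d₇ := by
    rcases hb.lt_or_gt with h | h
    · linarith [nb₁ h, nb₂ h, le_int_mul (neg_pos.2 h) h₂, le_int_mul (neg_pos.2 h) h₆]
    · linarith [pb₁ h, pb₂ h, le_int_mul h h₂, le_int_mul h h₆]
  exact lower.asymm upper
end

section
/- For all integers a, b, c, d with b ≠ 0 and a ≠ c, there do not exist nonnegative real numbers d₁, …, d₈ satisfying simultaneously the following four strict inequalities: (i) if b > 0 then d₁ + d₃ > d₂ + b·d₇, and if b < 0 then d₁ + d₃ > d₂ + (−b)·d₄; (ii) if b > 0 then d₂ + d₆ > d₁ + b·d₄, and if b < 0 then d₂ + d₆ > d₁ + (−b)·d₇; (iii) if a > c then d₄ + d₈ > d₅ + (a−c)·d₃, and if a < c then d₄ + d₈ > d₅ + (c−a)·d₆; (iv) if a > c then d₅ + d₇ > d₈ + (a−c)·d₆, and if a < c then d₅ + d₇ > d₈ + (c−a)·d₃. (This is the infeasibility of the ample-divisor inequality system attached to the primitive relations of the toric threefold Z″₁₃(a,b,c,d) of type [8-13″];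 it proves that Z″₁₃(a,b,c,d) is not projective whenever a ≠ c and b ≠ 0.) -/
/-- Nonnegative reals cannot each strictly exceed a positive integer multiple of the other. -/
theorem not_int_mul_lt_and_int_mul_lt {m n : ℤ} (hm : 0 < m) (hn : 0 < n) {x y : ℝ}
    (hx : 0 ≤ x) (hy : 0 ≤ y) : ¬ ((m : ℝ) * y < x ∧ (n : ℝ) * x < y) := by
  rintro ⟨hyx, hxy⟩
  have hm' : (1 : ℝ) ≤ m := by exact_mod_cast hm
  have hn' : (1 : ℝ) ≤ n := by exact_mod_cast hn
  linarith [le_mul_of_one_le_left hy hm', le_mul_of_one_le_left hx hn']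

/-- Infeasibility of the ample-divisor inequality system attached to the
primitive relations of the toric threefold `Z″₁₃(a,b,c,d)` of type [8-13″];
it proves that `Z″₁₃(a,b,c,d)` is not projective whenever `a ≠ c` and
`b ≠ 0`. -/
theorem oda_8_13''_nonprojective (a b c d : ℤ) (hb : b ≠ 0) (hac : a ≠ c) :
    ¬ ∃ d₁ d₂ d₃ d₄ d₅ d₆ d₇ d₈ : ℝ,
      0 ≤ d₁ ∧ 0 ≤ d₂ ∧ 0 ≤ d₃ ∧ 0 ≤ d₄ ∧ 0 ≤ d₅ ∧ 0 ≤ d₆ ∧ 0 ≤ d₇ ∧ 0 ≤ d₈ ∧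
      (b > 0 → d₁ + d₃ > d₂ + (b : ℝ) * d₇) ∧
      (b < 0 → d₁ + d₃ > d₂ + ((-b : ℤ) : ℝ) * d₄) ∧
      (b > 0 → d₂ + d₆ > d₁ + (b : ℝ) * d₄) ∧
      (b < 0 → d₂ + d₆ > d₁ + ((-b : ℤ) : ℝ) * d₇) ∧
      (a > c → d₄ + d₈ > d₅ + ((a - c : ℤ) : ℝ) * d₃) ∧
      (a < c → d₄ + d₈ > d₅ + ((c - a : ℤ) : ℝ) * d₆) ∧
      (a > c → d₅ + d₇ > d₈ + ((a - c : ℤ) : ℝ) * d₆) ∧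
      (a < c → d₅ + d₇ > d₈ + ((c - a : ℤ) : ℝ) * d₃) := by
  rintro ⟨d₁, d₂, d₃, d₄, d₅, d₆, d₇, d₈, -, -, h₃, h₄, -, h₆, h₇, -,
    hb₁, hb₂, hb₃, hb₄, hac₁, hac₂, hac₃, hac₄⟩
  obtain ⟨m, hm, hm_lt⟩ : ∃ m : ℤ, 0 < m ∧ (m : ℝ) * (d₄ + d₇) < d₃ + d₆ := by
    rcases hb.lt_or_gt with h | h
    · exact ⟨-b, by lia, by linarith [hb₂ h, hb₄ h]⟩
    · exact ⟨b, h, by linarith [hb₁ h, hb₃ h]⟩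
  obtain ⟨n, hn, hn_lt⟩ : ∃ n : ℤ, 0 < n ∧ (n : ℝ) * (d₃ + d₆) < d₄ + d₇ := by
    rcases hac.lt_or_gt with h | h
    · exact ⟨c - a, by lia, by linarith [hac₂ h, hac₄ h]⟩
    · exact ⟨a - c, by lia, by linarith [hac₁ h, hac₃ h]⟩
  exact not_int_mul_lt_and_int_mul_lt hm hn (add_nonneg h₃ h₆) (add_nonneg h₄ h₇) ⟨hm_lt, hn_lt⟩
end

section
/- Let a, b, c, d be integers satisfying: (1) a, c, d ∉ {−2, −1, 0, 1}; (2) c > a + 1; and (3) for all 2 ≤ i < j ≤ 8 and each sign ε ∈ {1, −1}, b > |ε − (yᵢzⱼ − yⱼzᵢ) + (xᵢzⱼ − xⱼzᵢ)|, where vₖ = (xₖ, yₖ, zₖ). Then for all 2 ≤ i < j ≤ 8, the determinant of the 3×3 integer matrix with rows v₁, vᵢ, vⱼ equals 1 or −1 if and only if (i, j) is one of the six pairs (2,4), (2,7), (3,4), (3,7), (4,6), (6,7). (Equivalently: the triples among {v₁, …, v₈} containing v₁ that form a ℤ-basis of ℤ³ are exactly {v₁,v₂,v₄}, {v₁,v₂,v₇},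 {v₁,v₃,v₄}, {v₁,v₃,v₇}, {v₁,v₄,v₆}, {v₁,v₆,v₇}.) -/
/-- First coordinates of the ray generators `v₁,…,v₈` of the fan of
`Z″₁₃(a,b,c,d)` of type [8-13″]. -/
def odaX : ℕ → ℤ
  | 1 => 1 | 2 => 1 | 3 => 0 | 4 => 0 | 5 => -1 | 6 => 0 | 7 => 0 | 8 => -1
  | _ => 0

/-- Second coordinates of the ray generators `v₁,…,v₈`. -/
def odaY (a c : ℤ) : ℕ → ℤ
  | 1 => 1 | 2 => 0 | 3 => -1 | 4 => 0 | 5 => a | 6 => 1 | 7 => 0 | 8 => c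
  | _ => 0

/-- Third coordinates of the ray generators `v₁,…,v₈`. -/
def odaZ (b d : ℤ) : ℕ → ℤ
  | 1 => b | 2 => 0 | 3 => 0 | 4 => -1 | 5 => d | 6 => 0 | 7 => 1 | 8 => d + 1
  | _ => 0

/-- If `b` exceeds `|ε - n|`, then `n + b * m = ε` forces `m = 0`. -/
theorem eq_zero_of_add_mul_eq_of_abs_sub_lt {b n m ε : ℤ} (hb : |ε - n| < b)
    (h : n + b * m = ε) : m = 0 := by
  have hbm : b * m = 0 :=
    Int.eq_zero_of_abs_lt_dvd (dvd_mul_right b m) (by rwa [eq_sub_of_add_eq' h])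
  exact (mul_eq_zero.mp hbm).resolve_left ((abs_nonneg _).trans_lt hb).ne'

/-- The determinant with rows `(1, 1, b)`, `(x, y, z)`, `(x', y', z')`, with the terms in `b`
collected. -/
theorem det_one_one_rows (b x y z x' y' z' : ℤ) :
    Matrix.det !![1, 1, b; x, y, z; x', y', z'] =
      (y * z' - y' * z) - (x * z' - x' * z) + b * (x * y' - x' * y) := by
  rw [Matrix.det_fin_three]
  simp
  ring

/-- Classification of the unimodular triples containing `v₁` in the proof of
Lemma 5.1 of [8-13″]: under conditions (1), (2), (3), for `2 ≤ i < j ≤ 8`,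
`det(v₁, vᵢ, vⱼ) = ±1` if and only if `(i,j)` is one of
`(2,4), (2,7), (3,4), (3,7), (4,6), (6,7)`. -/
theorem oda_lemma51_unimodular_triples (a b c d : ℤ)
    (h1a : a ≠ -2 ∧ a ≠ -1 ∧ a ≠ 0 ∧ a ≠ 1)
    (h1c : c ≠ -2 ∧ c ≠ -1 ∧ c ≠ 0 ∧ c ≠ 1)
    (h1d : d ≠ -2 ∧ d ≠ -1 ∧ d ≠ 0 ∧ d ≠ 1)
    (h2 : c > a + 1)
    (h3 : ∀ i j : ℕ, 2 ≤ i → i < j → j ≤ 8 → ∀ ε : ℤ, (ε = 1 ∨ ε = -1) →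
      b > |ε - (odaY a c i * odaZ b d j - odaY a c j * odaZ b d i)
            + (odaX i * odaZ b d j - odaX j * odaZ b d i)|) :
    ∀ i j : ℕ, 2 ≤ i → i < j → j ≤ 8 →
      ((Matrix.det !![odaX 1, odaY a c 1, odaZ b d 1;
                      odaX i, odaY a c i, odaZ b d i;
                      odaX j, odaY a c j, odaZ b d j] = 1 ∨
        Matrix.det !![odaX 1, odaY a c 1, odaZ b d 1;
                      odaX i, odaY a c i, odaZ b d i;
                      odaX j, odaY a c j, odaZ b d j] = -1) ↔
       ((i, j) = (2, 4) ∨ (i, j) = (2, 7) ∨ (i, j) = (3, 4) ∨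
        (i, j) = (3, 7) ∨ (i, j) = (4, 6) ∨ (i, j) = (6, 7))) := by
  intro i j hi hij hj
  simp only [show odaX 1 = 1 from rfl, show odaY a c 1 = 1 from rfl,
    show odaZ b d 1 = b from rfl, det_one_one_rows]
  have minor_eq_zero (ε : ℤ) (hε : ε = 1 ∨ ε = -1)
      (h : (odaY a c i * odaZ b d j - odaY a c j * odaZ b d i) -
        (odaX i * odaZ b d j - odaX j * odaZ b d i) +
        b * (odaX i * odaY a c j - odaX j * odaY a c i) = ε) :
      odaX i * odaY a c j - odaX j * odaY a c i = 0 := by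
    refine eq_zero_of_add_mul_eq_of_abs_sub_lt ?_ h
    rw [← sub_add]
    exact h3 i j hi hij hj ε hε
  have minor_one := minor_eq_zero 1 (Or.inl rfl)
  have minor_neg_one := minor_eq_zero (-1) (Or.inr rfl)
  clear minor_eq_zero h3
  have hi' : i ≤ 7 := by omega
  interval_cases i <;> interval_cases j <;>
    simp [odaX, odaY, odaZ] at minor_one minor_neg_one ⊢ <;> grind
end
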